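/- On the diagonal the Hessian is explicit: if 0 ≤ t < T and x = (a,a,a,a) for some a ∈ ℝ, then for all i, j ∈ {1,2,3,4} the second partial derivative ∂²_{x_i x_j} u^T(t,x) exists and equals (1/(16√2)) ∫_{−∞}^{∞} e^{−(T−t) r²} (Σ_{k=1}^4 α_{k,i} α_{k,j}) dr; since Σ_{k=1}^4 α_{k,i} α_{k,j} equals 6 when i = j and −2 when i ≠ j, this value is (6/(16√2)) √(π/(T−t)) on the diagonal of the Hessian and (−2/(16√2)) √(π/(T−t)) off it. -/

import Mathlib

open MeasureTheory Finset

noncomputable section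

/-- The 2π-periodic square wave ψ(r) = sign(sin r). -/
def psi (r : ℝ) : ℝ := Real.sign (Real.sin r)

/-- The vectors α_k ∈ ℝ⁴, α_{k,j} = 3/√2 if k = j and −1/√2 otherwise. -/
def alph : Fin 4 → Fin 4 → ℝ := fun k j => if k = j then 3 / Real.sqrt 2 else -(1 / Real.sqrt 2)

/-- The vector θ = (1/√2)(1,1,−1,−1) ∈ ℝ⁴. -/
def theta : Fin 4 → ℝ :=
  ![1 / Real.sqrt 2, 1 / Real.sqrt 2, -(1 / Real.sqrt 2), -(1 / Real.sqrt 2)]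

/-- Euclidean dot product on ℝ⁴. -/
def dot (a b : Fin 4 → ℝ) : ℝ := ∑ j, a j * b j

/-- The auxiliary function Λ(r,x). -/
def Lam (r : ℝ) (x : Fin 4 → ℝ) : ℝ :=
  psi (r * dot theta x + Real.pi / 2) * (∑ k, Real.cos (r * dot (alph k) x)) - 4
    - psi (r * dot theta x) * (∑ k, Real.sin (r * dot (alph k) x))

/-- x^o : the increasing rearrangement of the coordinates of x. -/
def sortv (x : Fin 4 → ℝ) : Fin 4 → ℝ := fun i => x (Tuple.sort x i)

/-- The function u^T(t,x). -/
def u (T t : ℝ) (x : Fin 4 → ℝ) : ℝ :=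
  -(1 / (16 * Real.sqrt 2)) *
      (∫ r : ℝ, Real.exp (-(T - t) * r ^ 2) * Lam r (sortv x) / r ^ 2)
    + (1 / 4) * ∑ i, x i + (1 / 2) * Real.sqrt ((T - t) * Real.pi / 2)

/-- Partial derivative in the i-th coordinate. -/
def pd (i : Fin 4) (f : (Fin 4 → ℝ) → ℝ) (x : Fin 4 → ℝ) : ℝ :=
  deriv (fun s => f (Function.update x i s)) (x i)

/-- Common form of the integrand. -/
def FF (σ U V W : ℝ) : ℝ :=
  4 * (|Real.cos U| * Real.cos V * Real.cos W) - 4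
    + 4 * σ * (|Real.sin U| * Real.sin V * Real.sin W)

lemma prod3_bound (a b c a' b' c' d : ℝ) (hb : |b| ≤ 1) (hc : |c| ≤ 1)
    (ha' : |a'| ≤ 1) (hb' : |b'| ≤ 1)
    (h1 : |a - a'| ≤ d) (h2 : |b - b'| ≤ d) (h3 : |c - c'| ≤ d) :
    |a * b * c - a' * b' * c'| ≤ 3 * d := by
  have hd : 0 ≤ d := (abs_nonneg _).trans h1
  have e : a * b * c - a' * b' * c' =
    (a - a') * b * c + a' * (b - b') * c + a' * b' * (c - c') := by ring
  rw [e]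
  refine (abs_add_three _ _ _).trans ?_
  simp only [abs_mul]
  have i1 : |a - a'| * |b| * |c| ≤ d * 1 * 1 := by gcongr
  have i2 : |a'| * |b - b'| * |c| ≤ 1 * d * 1 := by gcongr
  have i3 : |a'| * |b'| * |c - c'| ≤ 1 * 1 * d := by gcongr
  linarith

lemma prod3_bound' (a b c a' b' c' d m : ℝ) (hb : |b| ≤ m) (hc : |c| ≤ 1)
    (ha' : |a'| ≤ m) (ha'1 : |a'| ≤ 1) (hb' : |b'| ≤ m)
    (h1 : |a - a'| ≤ d) (h2 : |b - b'| ≤ d) (h3 : |c - c'| ≤ d) :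
    |a * b * c - a' * b' * c'| ≤ 3 * (d * m) := by
  have hd : 0 ≤ d := (abs_nonneg _).trans h1
  have hm : 0 ≤ m := (abs_nonneg _).trans hb
  have e : a * b * c - a' * b' * c' =
    (a - a') * b * c + a' * (b - b') * c + a' * b' * (c - c') := by ring
  rw [e]
  refine (abs_add_three _ _ _).trans ?_
  simp only [abs_mul]
  have i1 : |a - a'| * |b| * |c| ≤ d * m * 1 := by gcongr
  have i2 : |a'| * |b - b'| * |c| ≤ m * d * 1 := by gcongr
  have i3 : |a'| * |b'| * |c - c'| ≤ 1 * m * d := by gcongr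
  linarith

lemma cos_lip (r U U' R δ : ℝ) (hU : |U| ≤ R) (hU' : |U'| ≤ R) (h : |U - U'| ≤ δ) :
    |Real.cos (r * U) - Real.cos (r * U')| ≤ R * δ * r ^ 2 := by
  have hR : 0 ≤ R := (abs_nonneg _).trans hU
  rw [Real.cos_sub_cos, abs_mul, abs_mul]
  have h1 : |Real.sin ((r * U + r * U') / 2)| ≤ |r| * R := by
    refine Real.abs_sin_le_abs.trans ?_
    have : (r * U + r * U') / 2 = r * ((U + U') / 2) := by ring
    rw [this, abs_mul]
    gcongr
    rw [abs_le] at *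
    constructor <;> linarith
  have h2 : |Real.sin ((r * U - r * U') / 2)| ≤ |r| * (δ / 2) := by
    refine Real.abs_sin_le_abs.trans ?_
    have : (r * U - r * U') / 2 = r * ((U - U') / 2) := by ring
    rw [this, abs_mul]
    gcongr
    rw [abs_le] at *
    constructor <;> linarith
  calc |(-2:ℝ)| * |Real.sin ((r * U + r * U') / 2)| * |Real.sin ((r * U - r * U') / 2)|
      ≤ |(-2:ℝ)| * (|r| * R) * (|r| * (δ / 2)) := by gcongr
    _ = R * δ * r ^ 2 := by
      rw [← sq_abs r, abs_neg, abs_two]; ring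

lemma FF_lip (σ r R δ U V W U' V' W' : ℝ) (hσ : |σ| ≤ 1)
    (hU : |U| ≤ R) (hU' : |U'| ≤ R) (hV : |V| ≤ R) (hV' : |V'| ≤ R)
    (hW : |W| ≤ R) (hW' : |W'| ≤ R)
    (h1 : |U - U'| ≤ δ) (h2 : |V - V'| ≤ δ) (h3 : |W - W'| ≤ δ) :
    |FF σ (r * U) (r * V) (r * W) - FF σ (r * U') (r * V') (r * W')| ≤ 24 * R * δ * r ^ 2 := by
  have hs (X : ℝ) (hX : |X| ≤ R) : |Real.sin (r * X)| ≤ |r| * R := by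
    refine Real.abs_sin_le_abs.trans ?_
    rw [abs_mul]; gcongr
  have hs2 (X Y : ℝ) (hX : |X - Y| ≤ δ) : |Real.sin (r * X) - Real.sin (r * Y)| ≤ |r| * δ := by
    refine (Real.abs_sin_sub_sin_le _ _).trans ?_
    rw [← mul_sub, abs_mul]; gcongr
  have A := prod3_bound (|Real.cos (r * U)|) (Real.cos (r * V)) (Real.cos (r * W))
    (|Real.cos (r * U')|) (Real.cos (r * V')) (Real.cos (r * W')) (R * δ * r ^ 2)
    (Real.abs_cos_le_one _) (Real.abs_cos_le_one _)
    (by rw [abs_abs]; exact Real.abs_cos_le_one _) (Real.abs_cos_le_one _)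
    ((abs_abs_sub_abs_le_abs_sub _ _).trans (cos_lip r U U' R δ hU hU' h1))
    (cos_lip r V V' R δ hV hV' h2) (cos_lip r W W' R δ hW hW' h3)
  have B := prod3_bound' (|Real.sin (r * U)|) (Real.sin (r * V)) (Real.sin (r * W))
    (|Real.sin (r * U')|) (Real.sin (r * V')) (Real.sin (r * W')) (|r| * δ) (|r| * R)
    (hs _ hV) (Real.abs_sin_le_one _)
    (by rw [abs_abs]; exact hs _ hU') (by rw [abs_abs]; exact Real.abs_sin_le_one _) (hs _ hV')
    ((abs_abs_sub_abs_le_abs_sub _ _).trans (hs2 _ _ h1)) (hs2 _ _ h2) (hs2 _ _ h3)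
  have e2 : |r| * δ * (|r| * R) = R * δ * r ^ 2 := by rw [← sq_abs r]; ring
  rw [e2] at B
  unfold FF
  set x := |Real.cos (r * U)| * Real.cos (r * V) * Real.cos (r * W)
  set x' := |Real.cos (r * U')| * Real.cos (r * V') * Real.cos (r * W')
  set y := |Real.sin (r * U)| * Real.sin (r * V) * Real.sin (r * W)
  set y' := |Real.sin (r * U')| * Real.sin (r * V') * Real.sin (r * W')
  have e : 4 * x - 4 + 4 * σ * y - (4 * x' - 4 + 4 * σ * y') = 4 * (x - x') + 4 * (σ * (y - y')) := by
    ring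
  rw [e]
  refine (abs_add_le _ _).trans ?_
  rw [abs_mul, abs_mul 4, abs_mul σ]
  have : |σ| * |y - y'| ≤ 1 * (3 * (R * δ * r ^ 2)) := by gcongr
  norm_num
  linarith

lemma int_deriv (τ : ℝ) (hτ : 0 < τ) (σ : ℝ) (hσ : |σ| ≤ 1) (U V W : ℝ → ℝ)
    (hU : ∀ k k', |U k - U k'| ≤ |k - k'|) (hV : ∀ k k', |V k - V k'| ≤ |k - k'|)
    (hW : ∀ k k', |W k - W k'| ≤ |k - k'|) (D : ℝ → ℝ) (hDm : Continuous D) (k0 : ℝ)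
    (hD : ∀ᵐ r : ℝ, HasDerivAt (fun k => FF σ (r * U k) (r * V k) (r * W k)) (D r) k0) :
    HasDerivAt (fun k => ∫ r : ℝ, Real.exp (-τ * r ^ 2) * FF σ (r * U k) (r * V k) (r * W k) / r ^ 2)
      (∫ r : ℝ, Real.exp (-τ * r ^ 2) * D r / r ^ 2) k0 := by
  set R : ℝ := |U k0| + |V k0| + |W k0| + 1 with hR
  have hRp : 0 ≤ R := by positivity
  have bU : ∀ k ∈ Metric.ball k0 1, |U k| ≤ R := by
    intro k hk
    have h1 := hU k k0
    rw [Metric.mem_ball, Real.dist_eq] at hk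
    have h2 := abs_sub_abs_le_abs_sub (U k) (U k0)
    have := abs_nonneg (V k0)
    have := abs_nonneg (W k0)
    linarith
  have bV : ∀ k ∈ Metric.ball k0 1, |V k| ≤ R := by
    intro k hk
    have h1 := hV k k0
    rw [Metric.mem_ball, Real.dist_eq] at hk
    have h2 := abs_sub_abs_le_abs_sub (V k) (V k0)
    have := abs_nonneg (U k0)
    have := abs_nonneg (W k0)
    linarith
  have bW : ∀ k ∈ Metric.ball k0 1, |W k| ≤ R := by
    intro k hk
    have h1 := hW k k0
    rw [Metric.mem_ball, Real.dist_eq] at hk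
    have h2 := abs_sub_abs_le_abs_sub (W k) (W k0)
    have := abs_nonneg (U k0)
    have := abs_nonneg (V k0)
    linarith
  have hg := integrable_exp_neg_mul_sq hτ
  have hmeas : ∀ k, AEStronglyMeasurable (fun r : ℝ => Real.exp (-τ * r ^ 2) * FF σ (r * U k) (r * V k) (r * W k) / r ^ 2) := by
    intro k
    apply Measurable.aestronglyMeasurable
    apply Measurable.div _ (by fun_prop)
    apply Continuous.measurable
    unfold FF
    fun_prop
  have key : ∀ (r x y M : ℝ), 0 ≤ M → |x - y| ≤ M * r ^ 2 →
      |Real.exp (-τ * r ^ 2) * x / r ^ 2 - Real.exp (-τ * r ^ 2) * y / r ^ 2| ≤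
        Real.exp (-τ * r ^ 2) * M := by
    intro r x y M hM h
    rw [mul_div_assoc, mul_div_assoc, ← mul_sub, abs_mul, abs_of_pos (Real.exp_pos _), ← sub_div,
      abs_div, abs_of_nonneg (sq_nonneg r)]
    gcongr
    exact div_le_of_le_mul₀ (sq_nonneg r) hM h
  have hk0 : k0 ∈ Metric.ball k0 1 := Metric.mem_ball_self one_pos
  refine (hasDerivAt_integral_of_dominated_loc_of_lip
    (bound := fun r => Real.exp (-τ * r ^ 2) * (24 * R)) (Metric.ball_mem_nhds k0 one_pos)
    (Filter.Eventually.of_forall hmeas) ?_ ?_ ?_ (hg.mul_const _) ?_).2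
  · refine (hg.mul_const (24 * R * R)).mono' (hmeas k0) (Filter.Eventually.of_forall fun r => ?_)
    have h := FF_lip σ r R R (U k0) (V k0) (W k0) 0 0 0 hσ (bU _ hk0) (by simpa) (bV _ hk0)
      (by simpa) (bW _ hk0) (by simpa) (by simpa using bU _ hk0) (by simpa using bV _ hk0)
      (by simpa using bW _ hk0)
    have h2 := key r _ _ _ (by positivity) h
    have h0 : FF σ (r * 0) (r * 0) (r * 0) = 0 := by simp [FF]
    rw [h0, mul_zero, zero_div, sub_zero] at h2
    exact h2
  · apply Measurable.aestronglyMeasurable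
    apply Measurable.div _ (by fun_prop)
    apply Continuous.measurable
    fun_prop
  · refine Filter.Eventually.of_forall fun r => ?_
    apply LipschitzOnWith.of_dist_le_mul
    intro k hk k' hk'
    have h := FF_lip σ r R |k - k'| (U k) (V k) (W k) (U k') (V k') (W k') hσ (bU _ hk) (bU _ hk')
      (bV _ hk) (bV _ hk') (bW _ hk) (bW _ hk') (hU _ _) (hV _ _) (hW _ _)
    have h2 := key r _ _ _ (by positivity) h
    have hp : 0 ≤ Real.exp (-τ * r ^ 2) * (24 * R) := by positivity
    rw [Real.dist_eq, Real.dist_eq, Real.coe_nnabs, abs_of_nonneg hp]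
    refine h2.trans (le_of_eq (by ring))
  · filter_upwards [hD] with r hr
    exact (hr.const_mul _).div_const _

/-- The derivative integrand. -/
def DD (c h r : ℝ) : ℝ :=
  c * (r / √2) * (Real.sin (r * (h / √2)) * Real.cos (r * (h / √2)) *
    (|Real.cos (r * (h / √2))| + Real.sign h * |Real.sin (r * (h / √2))|))

lemma DD_cont (c h : ℝ) : Continuous (DD c h) := by
  unfold DD; fun_prop

lemma abs_sign_le (h : ℝ) : |Real.sign h| ≤ 1 := by
  rcases Real.sign_apply_eq h with e | e | e <;> rw [e] <;> norm_num

lemma J_deriv (τ : ℝ) (hτ : 0 < τ) (c : ℝ) :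
    HasDerivAt (fun h => ∫ r : ℝ, Real.exp (-τ * r ^ 2) * DD c h r / r ^ 2)
      (∫ r : ℝ, Real.exp (-τ * r ^ 2) * (c / 2)) 0 := by
  rw [hasDerivAt_iff_tendsto_slope]
  have h2 : (0:ℝ) < √2 := by positivity
  have h22 : √2 * √2 = (2:ℝ) := Real.mul_self_sqrt (by norm_num)
  have e : ∀ h : ℝ, slope (fun h => ∫ r : ℝ, Real.exp (-τ * r ^ 2) * DD c h r / r ^ 2) 0 h =
      ∫ r : ℝ, h⁻¹ * (Real.exp (-τ * r ^ 2) * DD c h r / r ^ 2) := by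
    intro h
    rw [slope_def_field, integral_const_mul]
    simp [DD]
    ring
  simp_rw [funext e]
  apply tendsto_integral_filter_of_dominated_convergence (fun r => Real.exp (-τ * r ^ 2) * |c|)
  · refine Filter.Eventually.of_forall fun h => ?_
    apply Measurable.aestronglyMeasurable
    apply Measurable.const_mul
    apply Measurable.div _ (by fun_prop)
    apply Continuous.measurable
    have := DD_cont c h
    fun_prop
  · filter_upwards [self_mem_nhdsWithin] with h hh
    refine Filter.Eventually.of_forall fun r => ?_
    have hh' : h ≠ 0 := hh
    by_cases hr : r = 0
    · simp [hr, DD]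
    have i1 : |DD c h r| ≤ |c| * |h| * r ^ 2 := by
      unfold DD
      rw [abs_mul, abs_mul, abs_mul, abs_mul]
      have a1 : |Real.sin (r * (h / √2))| ≤ |r| * |h| / √2 := by
        refine Real.abs_sin_le_abs.trans (le_of_eq ?_)
        rw [abs_mul, abs_div, abs_of_pos h2]; ring
      have a2 := Real.abs_cos_le_one (r * (h / √2))
      have a3 : |(|Real.cos (r * (h / √2))| + Real.sign h * |Real.sin (r * (h / √2))|)| ≤ 2 := by
        refine (abs_add_le _ _).trans ?_
        rw [abs_mul, abs_abs, abs_abs]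
        have := Real.abs_sin_le_one (r * (h / √2))
        have : |Real.sign h| * |Real.sin (r * (h / √2))| ≤ 1 * 1 := by
          gcongr; exact abs_sign_le h
        linarith
      calc _ ≤ |c| * |r / √2| * ((|r| * |h| / √2) * 1 * 2) := by gcongr
        _ = |c| * |h| * (|r| ^ 2 * (2 / (√2 * √2))) := by
          rw [abs_div, abs_of_pos h2]; field_simp
        _ = _ := by rw [h22, sq_abs]; ring
    rw [Real.norm_eq_abs, abs_mul, abs_div, abs_mul, abs_of_pos (Real.exp_pos _),
      abs_of_nonneg (sq_nonneg r), abs_inv]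
    have hhp : 0 < |h| := abs_pos.2 hh'
    have hrp : 0 < r ^ 2 := by positivity
    calc _ ≤ |h|⁻¹ * (Real.exp (-τ * r ^ 2) * (|c| * |h| * r ^ 2) / r ^ 2) := by gcongr
      _ = _ := by field_simp
  · exact (integrable_exp_neg_mul_sq hτ).mul_const _
  · have : ∀ᵐ r : ℝ, r ≠ 0 := by
      simp [ae_iff]
    filter_upwards [this] with r hr
    have t1 : Filter.Tendsto (fun h : ℝ => h⁻¹ * Real.sin (r * (h / √2))) (nhdsWithin 0 {0}ᶜ)
        (nhds (r / √2)) := by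
      have : HasDerivAt (fun h : ℝ => Real.sin (r * (h / √2))) (r / √2) 0 := by
        have := (((hasDerivAt_id (0:ℝ)).div_const (√2)).const_mul r).sin
        simpa [div_eq_mul_inv] using this
      rw [hasDerivAt_iff_tendsto_slope] at this
      refine this.congr fun h => ?_
      rw [slope_def_field]; simp; ring
    have t2 : Filter.Tendsto (fun h : ℝ => Real.cos (r * (h / √2))) (nhdsWithin 0 {0}ᶜ)
        (nhds 1) := by
      have : Continuous (fun h : ℝ => Real.cos (r * (h / √2))) := by fun_prop
      have := (this.tendsto 0).mono_left (nhdsWithin_le_nhds (s := {0}ᶜ))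
      simpa using this
    have t3 : Filter.Tendsto (fun h : ℝ => |Real.sin (r * (h / √2))|) (nhdsWithin 0 {0}ᶜ)
        (nhds 0) := by
      have : Continuous (fun h : ℝ => |Real.sin (r * (h / √2))|) := by fun_prop
      have := (this.tendsto 0).mono_left (nhdsWithin_le_nhds (s := {0}ᶜ))
      simpa using this
    have t4 : Filter.Tendsto (fun h : ℝ => Real.sign h * |Real.sin (r * (h / √2))|)
        (nhdsWithin 0 {0}ᶜ) (nhds 0) := by
      refine squeeze_zero_norm (fun h => ?_) t3
      rw [Real.norm_eq_abs, abs_mul, abs_abs]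
      have := mul_le_mul_of_nonneg_right (abs_sign_le h) (abs_nonneg (Real.sin (r * (h / √2))))
      linarith
    have t5 := ((t1.mul t2).mul (t2.abs.add t4)).const_mul
      (Real.exp (-τ * r ^ 2) * (c * (r / √2)) / r ^ 2)
    convert t5 using 1
    · ext h; unfold DD; ring
    · congr 1
      simp
      field_simp
      rw [Real.sq_sqrt (by norm_num)]

lemma hasDerivAt_abs_mul (y : ℝ) : HasDerivAt (fun y : ℝ => |y| * y) (2 * |y|) y := by
  by_cases hy : y = 0
  · subst hy
    rw [hasDerivAt_iff_tendsto_slope]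
    have : Filter.Tendsto (fun y : ℝ => |y|) (nhdsWithin 0 {0}ᶜ) (nhds (2 * |0|)) := by
      have := ((continuous_abs (G := ℝ)).tendsto 0).mono_left (nhdsWithin_le_nhds (s := {0}ᶜ))
      simpa using this
    refine this.congr' ?_
    filter_upwards [self_mem_nhdsWithin] with h hh
    have : h ≠ 0 := hh
    rw [slope_def_field]; simp; field_simp
  · have := (hasDerivAt_abs hy).mul (hasDerivAt_id y)
    refine HasDerivAt.congr_deriv this ?_
    simp only [id, sign_mul_self]; ring

lemma real_sign_mul (y : ℝ) : Real.sign y * y = |y| := by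
  rcases lt_trichotomy y 0 with h | h | h
  · rw [Real.sign_of_neg h, abs_of_neg h]; ring
  · simp [h]
  · rw [Real.sign_of_pos h, abs_of_pos h]; ring

lemma exists_perm (p q i j : Fin 4) (hpq : p ≠ q) (hij : i ≠ j) :
    ∃ σ : Equiv.Perm (Fin 4), σ p = i ∧ σ q = j := by
  refine ⟨(Equiv.swap p i).trans (Equiv.swap (Equiv.swap p i q) j), ?_, ?_⟩
  · rw [Equiv.trans_apply, Equiv.swap_apply_left, Equiv.swap_apply_of_ne_of_ne _ hij]
    intro h
    have h2 : Equiv.swap p i p = Equiv.swap p i q := by rw [Equiv.swap_apply_left]; exact h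
    exact hpq ((Equiv.swap p i).injective h2)
  · rw [Equiv.trans_apply, Equiv.swap_apply_left]

/-- base point with two perturbed coordinates -/
def pt (a : ℝ) (i j : Fin 4) (k h : ℝ) : Fin 4 → ℝ :=
  fun m => if m = i then k else if m = j then h else a

lemma sortv_pt (a k h : ℝ) (p q i j : Fin 4) (hpq : p ≠ q) (hij : i ≠ j)
    (hm : Monotone (pt a p q k h)) : sortv (pt a i j k h) = pt a p q k h := by
  obtain ⟨σ, h1, h2⟩ := exists_perm p q i j hpq hij
  have e : pt a i j k h ∘ σ = pt a p q k h := by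
    funext m
    have e1 : σ m = i ↔ m = p := by rw [← h1]; exact σ.injective.eq_iff
    have e2 : σ m = j ↔ m = q := by rw [← h2]; exact σ.injective.eq_iff
    simp [pt, e1, e2]
  have := (Tuple.comp_sort_eq_comp_iff_monotone (f := pt a i j k h) (σ := σ)).2 (by rw [e]; exact hm)
  rw [e] at this
  rw [this]; rfl

lemma mono4 (f : Fin 4 → ℝ) (h0 : f 0 ≤ f 1) (h1 : f 1 ≤ f 2) (h2 : f 2 ≤ f 3) : Monotone f := by
  rw [Fin.monotone_iff_le_succ]
  intro i
  fin_cases i <;> assumption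

lemma trig_cos (A B : ℝ) : Real.cos (3 * A - B) + Real.cos (3 * B - A) + 2 * Real.cos (A + B)
    = 4 * Real.cos (A + B) * Real.cos (A - B) ^ 2 := by
  have e1 : 3 * A - B = (A + B) + 2 * (A - B) := by ring
  have e2 : 3 * B - A = (A + B) - 2 * (A - B) := by ring
  rw [e1, e2, Real.cos_add (A + B), Real.cos_sub (A + B), Real.cos_two_mul]
  ring

lemma trig_sin (A B : ℝ) : Real.sin (3 * A - B) + Real.sin (3 * B - A) - 2 * Real.sin (A + B)
    = -4 * Real.sin (A + B) * Real.sin (A - B) ^ 2 := by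
  have e1 : 3 * A - B = (A + B) + 2 * (A - B) := by ring
  have e2 : 3 * B - A = (A + B) - 2 * (A - B) := by ring
  rw [e1, e2, Real.sin_add (A + B), Real.sin_sub (A + B), Real.cos_two_mul, Real.cos_sq']
  ring

lemma dot_alph (a k h : ℝ) (p q m : Fin 4) (hpq : p ≠ q) :
    dot (alph m) (pt a p q k h) = if m = p then (3 * (k - a) - (h - a)) / √2 else
      if m = q then (3 * (h - a) - (k - a)) / √2 else -((k - a) + (h - a)) / √2 := by
  fin_cases p <;> fin_cases q <;> first | exact absurd rfl hpq | skip
  all_goals fin_cases m <;> simp [dot, alph, pt, Fin.sum_univ_four] <;> ring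

lemma sum4 (f : Fin 4 → ℝ) (p q : Fin 4) (hpq : p ≠ q) (x y z : ℝ) (g : ℝ → ℝ)
    (hf : ∀ m, f m = if m = p then x else if m = q then y else z) :
    ∑ m, g (f m) = g x + g y + 2 * g z := by
  fin_cases p <;> fin_cases q <;> first | exact absurd rfl hpq | skip
  all_goals simp [hf, Fin.sum_univ_four] <;> ring

lemma Lam_pt (r a k h : ℝ) (p q : Fin 4) (hpq : p ≠ q) (A B : ℝ)
    (hA : A = r * ((k - a) / √2)) (hB : B = r * ((h - a) / √2)) :
    Lam r (pt a p q k h) =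
      Real.sign (Real.cos (r * dot theta (pt a p q k h))) * (4 * Real.cos (A + B) * Real.cos (A - B) ^ 2)
      - 4 + Real.sign (Real.sin (r * dot theta (pt a p q k h))) *
        (4 * Real.sin (A + B) * Real.sin (A - B) ^ 2) := by
  unfold Lam psi
  rw [Real.sin_add_pi_div_two,
    sum4 (fun m => dot (alph m) (pt a p q k h)) p q hpq _ _ _ (fun x => Real.cos (r * x))
      (fun m => dot_alph a k h p q m hpq),
    sum4 (fun m => dot (alph m) (pt a p q k h)) p q hpq _ _ _ (fun x => Real.sin (r * x))
      (fun m => dot_alph a k h p q m hpq)]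
  have e1 : r * ((3 * (k - a) - (h - a)) / √2) = 3 * A - B := by rw [hA, hB]; ring
  have e2 : r * ((3 * (h - a) - (k - a)) / √2) = 3 * B - A := by rw [hA, hB]; ring
  have e3 : r * (-((k - a) + (h - a)) / √2) = -(A + B) := by rw [hA, hB]; ring
  simp only [e1, e2, e3, Real.cos_neg, Real.sin_neg]
  rw [← trig_cos]
  have := trig_sin A B
  have e4 : 4 * Real.sin (A + B) * Real.sin (A - B) ^ 2 =
    -(Real.sin (3 * A - B) + Real.sin (3 * B - A) - 2 * Real.sin (A + B)) := by rw [this]; ring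
  rw [e4]
  ring

/-- sum direction -/
def XX (a h k : ℝ) : ℝ := (k - a) / √2 + (h - a) / √2
/-- difference direction -/
def YY (a h k : ℝ) : ℝ := (k - a) / √2 - (h - a) / √2

lemma case1 (r a k h : ℝ) (i j : Fin 4) (hij : i ≠ j) (h1 : a ≤ k) (h2 : k ≤ h) :
    Lam r (sortv (pt a i j k h)) = FF (-1) (r * XX a h k) (r * YY a h k) (r * YY a h k) := by
  rw [sortv_pt a k h 2 3 i j (by decide) hij
    (mono4 _ (by simp [pt]) (by simpa [pt]) (by simpa [pt])),
    Lam_pt r a k h 2 3 (by decide) _ _ rfl rfl]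
  have e : r * dot theta (pt a 2 3 k h) = -(r * XX a h k) := by
    simp [dot, theta, pt, Fin.sum_univ_four, XX]; ring
  rw [e, Real.cos_neg, Real.sin_neg, Real.sign_neg, ← mul_add, ← mul_sub]
  change Real.sign (Real.cos (r * XX a h k)) * (4 * Real.cos (r * XX a h k) * Real.cos (r * YY a h k) ^ 2)
    - 4 + -Real.sign (Real.sin (r * XX a h k)) * (4 * Real.sin (r * XX a h k) * Real.sin (r * YY a h k) ^ 2) = _
  rw [FF, ← real_sign_mul, ← real_sign_mul]
  ring

lemma case2 (r a k h : ℝ) (i j : Fin 4) (hij : i ≠ j) (h1 : k ≤ a) (h2 : a ≤ h) :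
    Lam r (sortv (pt a i j k h)) = FF 1 (r * YY a h k) (r * YY a h k) (r * XX a h k) := by
  rw [sortv_pt a k h 0 3 i j (by decide) hij
    (mono4 _ (by simpa [pt]) (by simp [pt]) (by simpa [pt])),
    Lam_pt r a k h 0 3 (by decide) _ _ rfl rfl]
  have e : r * dot theta (pt a 0 3 k h) = r * YY a h k := by
    congr 1
    simp [dot, theta, pt, Fin.sum_univ_four, YY]; ring
  rw [e, ← mul_add, ← mul_sub]
  change Real.sign (Real.cos (r * YY a h k)) * (4 * Real.cos (r * XX a h k) * Real.cos (r * YY a h k) ^ 2)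
    - 4 + Real.sign (Real.sin (r * YY a h k)) * (4 * Real.sin (r * XX a h k) * Real.sin (r * YY a h k) ^ 2) = _
  rw [FF, ← real_sign_mul, ← real_sign_mul]
  ring

lemma case3 (r a k h : ℝ) (i j : Fin 4) (hij : i ≠ j) (h1 : h ≤ a) (h2 : a ≤ k) :
    Lam r (sortv (pt a i j k h)) = FF (-1) (r * YY a h k) (r * YY a h k) (r * XX a h k) := by
  rw [sortv_pt a k h 3 0 i j (by decide) hij
    (mono4 _ (by simpa [pt]) (by simp [pt]) (by simpa [pt])),
    Lam_pt r a k h 3 0 (by decide) _ _ rfl rfl]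
  have e : r * dot theta (pt a 3 0 k h) = -(r * YY a h k) := by
    simp [dot, theta, pt, Fin.sum_univ_four, YY]; ring
  rw [e, Real.cos_neg, Real.sin_neg, Real.sign_neg, ← mul_add, ← mul_sub]
  change Real.sign (Real.cos (r * YY a h k)) * (4 * Real.cos (r * XX a h k) * Real.cos (r * YY a h k) ^ 2)
    - 4 + -Real.sign (Real.sin (r * YY a h k)) * (4 * Real.sin (r * XX a h k) * Real.sin (r * YY a h k) ^ 2) = _
  rw [FF, ← real_sign_mul, ← real_sign_mul]
  ring

lemma case4 (r a k h : ℝ) (i j : Fin 4) (hij : i ≠ j) (h1 : k ≤ a) (h2 : h ≤ k) :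
    Lam r (sortv (pt a i j k h)) = FF 1 (r * XX a h k) (r * YY a h k) (r * YY a h k) := by
  rw [sortv_pt a k h 1 0 i j (by decide) hij
    (mono4 _ (by simpa [pt]) (by simpa [pt]) (by simp [pt])),
    Lam_pt r a k h 1 0 (by decide) _ _ rfl rfl]
  have e : r * dot theta (pt a 1 0 k h) = r * XX a h k := by
    congr 1
    simp [dot, theta, pt, Fin.sum_univ_four, XX]; ring
  rw [e, ← mul_add, ← mul_sub]
  change Real.sign (Real.cos (r * XX a h k)) * (4 * Real.cos (r * XX a h k) * Real.cos (r * YY a h k) ^ 2)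
    - 4 + Real.sign (Real.sin (r * XX a h k)) * (4 * Real.sin (r * XX a h k) * Real.sin (r * YY a h k) ^ 2) = _
  rw [FF, ← real_sign_mul, ← real_sign_mul]
  ring

lemma X_deriv (a h k r : ℝ) : HasDerivAt (fun k => r * XX a h k) (r / √2) k := by
  have := ((((hasDerivAt_id k).sub_const a).div_const (√2)).add_const ((h - a) / √2)).const_mul r
  simpa [XX, div_eq_mul_inv] using this

lemma Y_deriv (a h k r : ℝ) : HasDerivAt (fun k => r * YY a h k) (r / √2) k := by
  have := ((((hasDerivAt_id k).sub_const a).div_const (√2)).sub_const ((h - a) / √2)).const_mul r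
  simpa [YY, div_eq_mul_inv] using this

lemma lip_aux (x : ℝ) : |x / √2| ≤ |x| := by
  rw [abs_div, abs_of_nonneg (Real.sqrt_nonneg 2)]
  exact div_le_self (abs_nonneg _) (Real.one_le_sqrt.2 (by norm_num))

lemma X_lip (a h k k' : ℝ) : |XX a h k - XX a h k'| ≤ |k - k'| := by
  have : XX a h k - XX a h k' = (k - k') / √2 := by unfold XX; ring
  rw [this]; exact lip_aux _

lemma Y_lip (a h k k' : ℝ) : |YY a h k - YY a h k'| ≤ |k - k'| := by
  have : YY a h k - YY a h k' = (k - k') / √2 := by unfold YY; ring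
  rw [this]; exact lip_aux _

lemma typeII (σ a h k r : ℝ) :
    HasDerivAt (fun k => FF σ (r * YY a h k) (r * YY a h k) (r * XX a h k))
      (r / √2 * (4 * (-2 * |Real.cos (r * YY a h k)| * Real.sin (r * YY a h k) * Real.cos (r * XX a h k)
        - |Real.cos (r * YY a h k)| * Real.cos (r * YY a h k) * Real.sin (r * XX a h k))
        + 4 * σ * (2 * |Real.sin (r * YY a h k)| * Real.cos (r * YY a h k) * Real.sin (r * XX a h k)
        + |Real.sin (r * YY a h k)| * Real.sin (r * YY a h k) * Real.cos (r * XX a h k)))) k := by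
  have hX := X_deriv a h k r
  have hY := Y_deriv a h k r
  have c1 := (hasDerivAt_abs_mul _).comp k hY.cos
  have s1 := (hasDerivAt_abs_mul _).comp k hY.sin
  have := (((c1.mul hX.cos).const_mul 4).sub_const 4).add ((s1.mul hX.sin).const_mul (4 * σ))
  refine HasDerivAt.congr_deriv this ?_
  simp only [Function.comp, Pi.mul_apply]
  ring

lemma typeI (σ a h k r : ℝ) (hc : Real.cos (r * XX a h k) ≠ 0) (hs : Real.sin (r * XX a h k) ≠ 0) :
    HasDerivAt (fun k => FF σ (r * XX a h k) (r * YY a h k) (r * YY a h k))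
      (r / √2 * (4 * (-((SignType.sign (Real.cos (r * XX a h k)) : ℝ) * Real.sin (r * XX a h k)) * Real.cos (r * YY a h k) ^ 2
        - 2 * |Real.cos (r * XX a h k)| * Real.cos (r * YY a h k) * Real.sin (r * YY a h k))
        + 4 * σ * ((SignType.sign (Real.sin (r * XX a h k)) : ℝ) * Real.cos (r * XX a h k) * Real.sin (r * YY a h k) ^ 2
        + 2 * |Real.sin (r * XX a h k)| * Real.sin (r * YY a h k) * Real.cos (r * YY a h k)))) k := by
  have hX := X_deriv a h k r
  have hY := Y_deriv a h k r
  have c1 := (hasDerivAt_abs hc).comp k hX.cos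
  have s1 := (hasDerivAt_abs hs).comp k hX.sin
  have := ((((c1.mul hY.cos).mul hY.cos).const_mul 4).sub_const 4).add
    (((s1.mul hY.sin).mul hY.sin).const_mul (4 * σ))
  refine HasDerivAt.congr_deriv this ?_
  simp only [Function.comp, Pi.mul_apply]
  ring

/-- integral value -/
def II (τ c h : ℝ) : ℝ := ∫ r : ℝ, Real.exp (-τ * r ^ 2) * DD c h r / r ^ 2

lemma II_zero (τ c : ℝ) : II τ c 0 = 0 := by simp [II, DD]

lemma ae_nonzero (b : ℝ) (hb : b ≠ 0) : ∀ᵐ r : ℝ, Real.cos (r * b) ≠ 0 ∧ Real.sin (r * b) ≠ 0 := by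
  have hc : (Set.range fun n : ℤ => (n : ℝ) * Real.pi / (2 * b)).Countable := Set.countable_range _
  have := hc.ae_notMem (volume : Measure ℝ)
  filter_upwards [this] with r hr
  rw [← mul_ne_zero_iff]
  intro h0
  apply hr
  have h2 : Real.sin (2 * (r * b)) = 0 := by rw [Real.sin_two_mul]; linarith
  obtain ⟨n, hn⟩ := Real.sin_eq_zero_iff.1 h2
  refine ⟨n, ?_⟩
  simp only [hn]
  field_simp

/-- type II, off-diagonal, base `k = a`. -/
lemma intII (τ : ℝ) (hτ : 0 < τ) (σ a h : ℝ) (hσ : |σ| ≤ 1) (hs : σ = Real.sign (h - a) ∨ h = a) :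
    HasDerivAt (fun k => ∫ r : ℝ, Real.exp (-τ * r ^ 2) *
      FF σ (r * YY a h k) (r * YY a h k) (r * XX a h k) / r ^ 2) (II τ 4 (h - a)) a := by
  refine int_deriv τ hτ σ hσ _ _ _ (Y_lip a h) (Y_lip a h) (X_lip a h) _ (DD_cont _ _) a
    (Filter.Eventually.of_forall fun r => ?_)
  convert typeII σ a h a r using 1
  have e1 : r * YY a h a = - (r * ((h - a) / √2)) := by unfold YY; ring
  have e2 : r * XX a h a = r * ((h - a) / √2) := by unfold XX; ring
  rw [e1, e2, DD]
  simp only [Real.cos_neg, Real.sin_neg, abs_neg]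
  rcases hs with hs | hs
  · rw [hs]; ring
  · rw [hs]; simp

/-- type I, off-diagonal, base `k = a`. -/
lemma intI (τ : ℝ) (hτ : 0 < τ) (σ a h : ℝ) (hσ : |σ| ≤ 1) (hs : σ = -Real.sign (h - a)) (hh : h ≠ a) :
    HasDerivAt (fun k => ∫ r : ℝ, Real.exp (-τ * r ^ 2) *
      FF σ (r * XX a h k) (r * YY a h k) (r * YY a h k) / r ^ 2) (II τ 4 (h - a)) a := by
  refine int_deriv τ hτ σ hσ _ _ _ (X_lip a h) (Y_lip a h) (Y_lip a h) _ (DD_cont _ _) a ?_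
  have hb : (h - a) / √2 ≠ 0 := div_ne_zero (sub_ne_zero.2 hh) (by positivity)
  filter_upwards [ae_nonzero _ hb] with r hr
  have e1 : r * YY a h a = - (r * ((h - a) / √2)) := by unfold YY; ring
  have e2 : r * XX a h a = r * ((h - a) / √2) := by unfold XX; ring
  convert typeI σ a h a r (by rw [e2]; exact hr.1) (by rw [e2]; exact hr.2) using 1
  rw [e1, e2, DD]
  simp only [Real.cos_neg, Real.sin_neg]
  set B := r * ((h - a) / √2)
  have f1 := sign_mul_self (Real.cos B)
  have f2 := sign_mul_self (Real.sin B)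
  rw [hs]
  linear_combination (r / √2 * 4 * Real.sin B * Real.cos B) * f1 + (r / √2 * 4 * (Real.sign (h - a)) * Real.sin B * Real.cos B) * f2

/-- diagonal case -/
lemma intD (τ : ℝ) (hτ : 0 < τ) (σ a k : ℝ) (hσ : |σ| ≤ 1) (hs : σ = -Real.sign (k - a) ∨ k = a) :
    HasDerivAt (fun k => ∫ r : ℝ, Real.exp (-τ * r ^ 2) *
      FF σ (r * YY a a k) (r * YY a a k) (r * XX a a k) / r ^ 2) (II τ (-12) (k - a)) k := by
  refine int_deriv τ hτ σ hσ _ _ _ (Y_lip a a) (Y_lip a a) (X_lip a a) _ (DD_cont _ _) k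
    (Filter.Eventually.of_forall fun r => ?_)
  convert typeII σ a a k r using 1
  have e1 : r * YY a a k = (r * ((k - a) / √2)) := by unfold YY; ring
  have e2 : r * XX a a k = r * ((k - a) / √2) := by unfold XX; ring
  rw [e1, e2, DD]
  rcases hs with hs | hs
  · rw [hs]; ring
  · rw [hs]; simp

lemma glue (f g₁ g₂ : ℝ → ℝ) (d x : ℝ) (h1 : HasDerivAt g₁ d x) (h2 : HasDerivAt g₂ d x)
    (e1 : ∀ᶠ k in nhds x, k ≤ x → f k = g₁ k) (e2 : ∀ᶠ k in nhds x, x ≤ k → f k = g₂ k) :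
    HasDerivAt f d x := by
  rw [← hasDerivWithinAt_univ, ← Set.Iic_union_Ici (a := x)]
  apply HasDerivWithinAt.union
  · refine h1.hasDerivWithinAt.congr_of_eventuallyEq ?_ (e1.self_of_nhds le_rfl)
    exact eventually_nhdsWithin_iff.2 e1
  · refine h2.hasDerivWithinAt.congr_of_eventuallyEq ?_ (e2.self_of_nhds le_rfl)
    exact eventually_nhdsWithin_iff.2 e2

/-- integral part of `u` -/
def KK (τ : ℝ) (x : Fin 4 → ℝ) : ℝ := ∫ r : ℝ, Real.exp (-τ * r ^ 2) * Lam r (sortv x) / r ^ 2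

lemma KK_off (τ : ℝ) (hτ : 0 < τ) (a h : ℝ) (i j : Fin 4) (hij : i ≠ j) :
    HasDerivAt (fun k => KK τ (pt a i j k h)) (II τ 4 (h - a)) a := by
  rcases lt_trichotomy h a with hh | hh | hh
  · have hsg : Real.sign (h - a) = -1 := Real.sign_of_neg (by linarith)
    refine glue _ _ _ _ _ (intI τ hτ 1 a h (by norm_num) (by rw [hsg]; norm_num) hh.ne)
      (intII τ hτ (-1) a h (by norm_num) (Or.inl hsg.symm)) ?_ ?_
    · filter_upwards [Ioi_mem_nhds hh] with k hk hk2
      simp only [KK, case4 _ a k h i j hij hk2 (le_of_lt hk)]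
    · filter_upwards with k hk
      simp only [KK, case3 _ a k h i j hij hh.le hk]
  · refine glue _ _ _ _ _ (intII τ hτ 1 a h (by norm_num) (Or.inr hh))
      (intII τ hτ (-1) a h (by norm_num) (Or.inr hh)) ?_ ?_
    · filter_upwards with k hk
      simp only [KK, case2 _ a k h i j hij hk hh.ge]
    · filter_upwards with k hk
      simp only [KK, case3 _ a k h i j hij hh.le hk]
  · have hsg : Real.sign (h - a) = 1 := Real.sign_of_pos (by linarith)
    refine glue _ _ _ _ _ (intII τ hτ 1 a h (by norm_num) (Or.inl hsg.symm))
      (intI τ hτ (-1) a h (by norm_num) (by rw [hsg]) hh.ne') ?_ ?_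
    · filter_upwards with k hk
      simp only [KK, case2 _ a k h i j hij hk hh.le]
    · filter_upwards [Iio_mem_nhds hh] with k hk hk2
      simp only [KK, case1 _ a k h i j hij hk2 (le_of_lt hk)]

lemma KK_diag (τ : ℝ) (hτ : 0 < τ) (a k : ℝ) (i j : Fin 4) (hij : i ≠ j) :
    HasDerivAt (fun k => KK τ (pt a i j k a)) (II τ (-12) (k - a)) k := by
  rcases lt_trichotomy k a with hh | hh | hh
  · have hsg : Real.sign (k - a) = -1 := Real.sign_of_neg (by linarith)
    refine (intD τ hτ 1 a k (by norm_num) (Or.inl (by rw [hsg]; norm_num))).congr_of_eventuallyEq ?_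
    filter_upwards [Iio_mem_nhds hh] with k hk
    simp only [KK, case2 _ a k a i j hij (le_of_lt hk) le_rfl]
  · refine glue _ _ _ _ _ (intD τ hτ 1 a k (by norm_num) (Or.inr hh))
      (intD τ hτ (-1) a k (by norm_num) (Or.inr hh)) ?_ ?_
    · filter_upwards with k' hk
      simp only [KK, case2 _ a k' a i j hij (hk.trans hh.le) le_rfl]
    · filter_upwards with k' hk
      simp only [KK, case3 _ a k' a i j hij le_rfl (hh.ge.trans hk)]
  · have hsg : Real.sign (k - a) = 1 := Real.sign_of_pos (by linarith)
    refine (intD τ hτ (-1) a k (by norm_num) (Or.inl (by rw [hsg]))).congr_of_eventuallyEq ?_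
    filter_upwards [Ioi_mem_nhds hh] with k hk
    simp only [KK, case3 _ a k a i j hij le_rfl (le_of_lt hk)]

lemma u_deriv (T t a h k d : ℝ) (i j : Fin 4) (hij : i ≠ j)
    (hK : HasDerivAt (fun k => KK (T - t) (pt a i j k h)) d k) :
    HasDerivAt (fun k => u T t (pt a i j k h)) (1 / 4 - (1 / (16 * √2)) * d) k := by
  have hs : ∀ k, ∑ m, pt a i j k h m = k + (h + 2 * a) := by
    intro k
    have := sum4 (pt a i j k h) i j hij k h a id (fun m => rfl)
    simp only [id] at this
    rw [this]; ring
  have := ((hK.const_mul (-(1 / (16 * √2)))).add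
    (((hasDerivAt_id k).add_const (h + 2 * a)).const_mul (1 / 4))).add_const
      ((1 / 2) * Real.sqrt ((T - t) * Real.pi / 2))
  have e : (fun k => u T t (pt a i j k h)) = fun x =>
      ((fun y => -(1 / (16 * √2)) * KK (T - t) (pt a i j y h)) +
        fun y => 1 / 4 * (id y + (h + 2 * a))) x + 1 / 2 * √((T - t) * Real.pi / 2) := by
    funext k
    simp only [u, hs, KK, Pi.add_apply, id]
  rw [e]
  refine HasDerivAt.congr_deriv this ?_
  ring

lemma pd_eq (T t : ℝ) (htT : t < T) (a s : ℝ) (i j : Fin 4) :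
    pd i (u T t) (Function.update (fun _ : Fin 4 => a) j s) =
      1 / 4 - (1 / (16 * √2)) * II (T - t) (if i = j then -12 else 4) (s - a) := by
  have hτ : 0 < T - t := by linarith
  unfold pd
  by_cases hij : i = j
  · subst hij
    obtain ⟨j', hj⟩ := exists_ne i
    rw [if_pos rfl]
    have e : (fun s' => u T t (Function.update (Function.update (fun _ : Fin 4 => a) i s) i s')) =
        fun s' => u T t (pt a i j' s' a) := by
      funext s'
      congr 1
      funext m
      by_cases hm : m = i <;> simp [pt, Function.update_apply, hm]
    rw [e, Function.update_self]
    exact (u_deriv T t a a s _ i j' hj.symm (KK_diag _ hτ a s i j' hj.symm)).deriv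
  · rw [if_neg hij]
    have e : (fun s' => u T t (Function.update (Function.update (fun _ : Fin 4 => a) j s) i s')) =
        fun s' => u T t (pt a i j s' s) := by
      funext s'
      congr 1
      funext m
      simp [pt, Function.update_apply]
    rw [e, Function.update_of_ne hij]
    exact (u_deriv T t a s a _ i j hij (KK_off _ hτ a s i j hij)).deriv

lemma sum_alph (i j : Fin 4) : ∑ k, alph k i * alph k j = if i = j then 6 else -2 := by
  have h2 : √2 * √2 = (2:ℝ) := Real.mul_self_sqrt (by norm_num)
  have h3 : (√2)⁻¹ * (√2)⁻¹ = (1 / 2 : ℝ) := by rw [← mul_inv, h2]; norm_num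
  fin_cases i <;> fin_cases j <;> simp [alph, Fin.sum_univ_four, div_eq_mul_inv] <;> linarith

/-- on the diagonal x = (a,a,a,a), the Hessian entries of u^T are explicit. -/
theorem u_hessian_diagonal (T t : ℝ) (ht : 0 ≤ t) (htT : t < T) (a : ℝ) (i j : Fin 4) :
    HasDerivAt (fun s => pd i (u T t) (Function.update (fun _ : Fin 4 => a) j s))
      ((1 / (16 * Real.sqrt 2)) *
        (∫ r : ℝ, Real.exp (-(T - t) * r ^ 2) * ∑ k, alph k i * alph k j)) a ∧
    (1 / (16 * Real.sqrt 2)) *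
        (∫ r : ℝ, Real.exp (-(T - t) * r ^ 2) * ∑ k, alph k i * alph k j)
      = ((if i = j then (6 : ℝ) else -2) / (16 * Real.sqrt 2)) *
          Real.sqrt (Real.pi / (T - t)) := by
  constructor
  · have hτ : 0 < T - t := by linarith
    have e : (fun s => pd i (u T t) (Function.update (fun _ : Fin 4 => a) j s)) = fun s =>
        1 / 4 - (1 / (16 * √2)) * II (T - t) (if i = j then -12 else 4) (s - a) := by
      funext s; exact pd_eq T t htT a s i j
    rw [e]
    have hJ := J_deriv (T - t) hτ (if i = j then -12 else 4)
    have h0 : a - a = 0 := sub_self a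
    rw [← h0] at hJ
    have hJ2 := HasDerivAt.comp_sub_const a a hJ
    have := (hJ2.const_mul (1 / (16 * √2))).const_sub (1 / 4)
    refine HasDerivAt.congr_deriv this ?_
    symm
    rw [← mul_neg, ← integral_neg]
    congr 1
    apply integral_congr_ae
    filter_upwards with r
    rw [sum_alph]
    split_ifs <;> ring
  · rw [sum_alph, integral_mul_const, integral_gaussian]
    ring

end
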